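/- Fix n ≥ 2 and let Q ⊆ R be such that the action of t strictly confines R into Q, and set S = Q ∪ {t, t⁻¹}. Then there exist a proper subgroup H of ℤ_n and N ∈ ℕ such that, in the lamplighter group L_n: every element of S is a product of at most N elements of S_H ∪ S_H⁻¹, and every element of S_H is a product of at most N elements of S ∪ S⁻¹, where S_H = Q_H ∪ {t, t⁻¹} and Q_H = {p ∈ R : the coefficient of t^{−i} in p lies in H for all i ≥ 1}. In particular S and S_H give bi-Lipschitz equivalent word metrics on L_n. -/

import Mathlib

open Function Set Pointwise

/-- The base `A = ⊕_{i∈ℤ} ℤ_n` of the lamplighter group, identified with the additive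
group of the Laurent polynomial ring `R = ℤ_n[t, t⁻¹]` (a Laurent polynomial is its
finitely supported coefficient function `ℤ →₀ ℤ_n`). -/
abbrev Rn (n : ℕ) := ℤ →₀ ZMod n

/-- Multiplication by `t^m` on `R = ℤ_n[t, t⁻¹]`: the coefficient of `t^j` in `t^m·p`
is the coefficient of `t^{j−m}` in `p`. -/
def tmul (n : ℕ) (m : ℤ) : Rn n ≃+ Rn n :=
  Finsupp.domCongr (Equiv.addRight m)

/-- `B₊`: the set of Laurent polynomials all of whose exponents are `≥ 0`. -/
def Bplus (n : ℕ) : Set (Rn n) := {p | ∀ i : ℤ, i < 0 → p i = 0}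

/-- The action of `t` confines `R` into `Q`: (a) `tQ ⊆ Q`; (b) every `p ∈ R` has
`t^m p ∈ Q` for some `m ≥ 0`; (c) `t^{n₀}(Q + Q) ⊆ Q` for some `n₀ ≥ 0`. -/
def ConfinesT (n : ℕ) (Q : Set (Rn n)) : Prop :=
  (∀ q ∈ Q, tmul n 1 q ∈ Q) ∧
  (∀ p : Rn n, ∃ m : ℕ, tmul n m p ∈ Q) ∧
  (∃ n₀ : ℕ, ∀ q₁ ∈ Q, ∀ q₂ ∈ Q, tmul n n₀ (q₁ + q₂) ∈ Q)

/-- Strictly confining: moreover `tQ` is a proper subset of `Q`. -/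
def StrictlyConfinesT (n : ℕ) (Q : Set (Rn n)) : Prop :=
  ConfinesT n Q ∧ ⇑(tmul n 1) '' Q ⊂ Q

/-- The lamplighter group `L_n = ℤ_n wr ℤ = (⊕_{ℤ} ℤ_n) ⋊ ℤ`, where the generator `t`
of `ℤ` acts on the base by the shift (= multiplication by `t`). -/
abbrev Ln (n : ℕ) := SemidirectProduct (Multiplicative (Rn n)) (Multiplicative ℤ)
  (zpowersHom (MulAut (Multiplicative (Rn n))) (AddEquiv.toMultiplicative (tmul n 1)))

/-- The element `t` of the lamplighter group. -/
noncomputable def tL (n : ℕ) : Ln n := SemidirectProduct.inr (Multiplicative.ofAdd (1 : ℤ))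

/-- The embedding of the base `A = R` into the lamplighter group. -/
noncomputable def ι (n : ℕ) (p : Rn n) : Ln n := SemidirectProduct.inl (Multiplicative.ofAdd p)

/-- the generating set `S = Q ∪ {t, t⁻¹}` of `L_n` associated with `Q ⊆ R`. -/
def Sgen (n : ℕ) (Q : Set (Rn n)) : Set (Ln n) :=
  (ι n '' Q) ∪ {tL n, (tL n)⁻¹}

/-- products of at most `N` elements of `S ∪ S⁻¹`. -/
def wordBall {W : Type*} [Group W] (S : Set W) (N : ℕ) : Set W :=
  {w | ∃ l : List W, l.length ≤ N ∧ (∀ x ∈ l, x ∈ S ∪ S⁻¹) ∧ l.prod = w}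

/-- `Q_H = {p ∈ R : the coefficient of t^{−i} in p lies in H for all i ≥ 1}`. -/
def QHlamp (n : ℕ) (H : AddSubgroup (ZMod n)) : Set (Rn n) :=
  {p | ∀ i : ℤ, 1 ≤ i → p (-i) ∈ H}


lemma tmul_apply' (n : ℕ) (m : ℤ) (p : Rn n) (x : ℤ) : tmul n m p x = p (x - m) := by
  simp [tmul, Finsupp.domCongr, Finsupp.equivMapDomain_apply, sub_eq_add_neg]

lemma tmul_tmul (n : ℕ) (a b : ℤ) (p : Rn n) : tmul n a (tmul n b p) = tmul n (a + b) p := by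
  ext x; simp only [tmul_apply']; congr 1; ring

lemma tmul_zero' (n : ℕ) (p : Rn n) : tmul n 0 p = p := by
  ext x; simp [tmul_apply']

lemma tmul_single (n : ℕ) (m x : ℤ) (c : ZMod n) :
    tmul n m (Finsupp.single x c) = Finsupp.single (x + m) c := by
  ext y; simp only [tmul_apply', Finsupp.single_apply]
  congr 1; simp only [eq_iff_iff]; constructor <;> intro h <;> linarith

structure Good (n : ℕ) (D : ℤ → Rn n → Prop) (n0 : ℕ) : Prop where
  pos : 1 ≤ n0
  mono : ∀ m m' p, m ≤ m' → D m p → D m' p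
  shift : ∀ m k p, D (m + k) p → D m (tmul n k p)
  shift' : ∀ m k p, D m (tmul n k p) → D (m + k) p
  add : ∀ m p q, D m p → D m q → D (m + n0) (p + q)
  abs : ∀ p, ∃ m : ℤ, D m p

lemma good_of_confines (n : ℕ) (Q : Set (Rn n)) (hQ : ConfinesT n Q) :
    ∃ n0, Good n (fun m p => tmul n m p ∈ Q) n0 := by
  obtain ⟨h1, h2, n0, h3⟩ := hQ
  have hm : ∀ k : ℕ, ∀ q ∈ Q, tmul n k q ∈ Q := by
    intro k
    induction k with
    | zero => intro q hq; simpa [tmul_zero'] using hq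
    | succ k ih =>
      intro q hq
      have := h1 _ (ih q hq)
      rw [tmul_tmul] at this
      push_cast; rwa [add_comm]
  have mono : ∀ (m m' : ℤ) (p : Rn n), m ≤ m' → tmul n m p ∈ Q → tmul n m' p ∈ Q := by
    intro m m' p hmm hp
    have := hm (m' - m).toNat _ hp
    rw [tmul_tmul] at this
    convert this using 3
    rw [Int.toNat_of_nonneg (by omega)]; ring
  refine ⟨n0 + 1, by omega, mono, ?_, ?_, ?_, ?_⟩
  · intro m k p h; rwa [tmul_tmul]
  · intro m k p h; rwa [tmul_tmul] at h
  · intro m p q hp hq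
    have := h3 _ hp _ hq
    rw [← map_add, tmul_tmul] at this
    exact mono _ _ _ (by push_cast; omega) this
  · intro p; obtain ⟨m, h⟩ := h2 p; exact ⟨m, h⟩

namespace Good
variable {n : ℕ} {D : ℤ → Rn n → Prop} {n0 : ℕ}

lemma zero (hD : Good n D n0) (m : ℤ) : D m 0 := by
  obtain ⟨k, hk⟩ := hD.abs 0
  have := hD.shift' m (k - m) 0
  rw [map_zero] at this
  have h2 := hD.shift m (k - m) 0 (by rwa [add_sub_cancel])
  rwa [map_zero] at h2

lemma sum (hD : Good n D n0) (m : ℤ) (k : ℕ) (f : ℕ → Rn n) (hf : ∀ j, D m (f j)) :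
    D (m + n0 * k) (∑ j ∈ Finset.range k, f j) := by
  induction k with
  | zero => simpa using hD.zero m
  | succ k ih =>
    rw [Finset.sum_range_succ]
    have := hD.add _ _ _ ih (hD.mono _ (m + n0 * k) _ (le_add_of_nonneg_right (by positivity)) (hf k))
    convert this using 1
    push_cast; ring

lemma nsmul (hD : Good n D n0) (hn : n ≠ 0) (m : ℤ) (p : Rn n) (hp : D m p) (a : ℕ) :
    D (m + n0 * n) (a • p) := by
  have h : a • p = (a % n) • p := by
    ext x
    simp only [Finsupp.smul_apply, nsmul_eq_mul, ZMod.natCast_mod]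
  rw [h]
  have := hD.sum m (a % n) (fun _ => p) (fun _ => hp)
  simp only [Finset.sum_const, Finset.card_range] at this
  refine hD.mono _ _ _ ?_ this
  have : a % n ≤ n := (Nat.mod_lt _ (by omega)).le
  gcongr

lemma neg (hD : Good n D n0) (hn : n ≠ 0) (m : ℤ) (p : Rn n) (hp : D m p) :
    D (m + n0 * n) (-p) := by
  have := hD.nsmul hn m p hp (n - 1)
  convert this using 1
  ext x
  simp only [Finsupp.smul_apply, nsmul_eq_mul, Finsupp.neg_apply]
  rw [Nat.cast_sub (by omega)]; simp

lemma horner1 (hD : Good n D n0) (m : ℤ) (L : ℕ) : ∀ (f : ℕ → Rn n) (hf : ∀ j, D m (f j)),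
    D (m + n0) (∑ j ∈ Finset.range L, tmul n (n0 * j) (f j)) := by
  induction L with
  | zero => intro f hf; simpa using hD.zero _
  | succ L ih =>
    intro f hf
    rw [Finset.sum_range_succ']
    refine hD.add _ _ _ ?_ ?_
    · have := hD.shift m n0 _ (ih (fun j => f (j + 1)) (fun j => hf _))
      rw [map_sum] at this
      convert this using 2 with j hj
      rw [tmul_tmul]; push_cast; congr 2; ring
    · simpa [tmul_zero'] using hf 0

lemma horner (hD : Good n D n0) (m : ℤ) (L : ℕ) (f : ℕ → Rn n) (hf : ∀ j, D m (f j)) :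
    D (m + n0 + n0 * n0) (∑ j ∈ Finset.range L, tmul n j (f j)) := by
  -- extend by zero
  let g : ℕ → Rn n := fun j => if j < L then f j else 0
  have hg : ∀ j, D m (g j) := by
    intro j; simp only [g]; split_ifs
    · exact hf j
    · exact hD.zero _
  have e1 : ∑ j ∈ Finset.range L, tmul n j (f j) = ∑ j ∈ Finset.range (n0 * L), tmul n j (g j) := by
    rw [← Finset.sum_subset (s₁ := Finset.range L) (s₂ := Finset.range (n0 * L))]
    · apply Finset.sum_congr rfl
      intro j hj; simp [g, Finset.mem_range.1 hj]
    · intro j hj; simp only [Finset.mem_range] at *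
      have := hD.pos; nlinarith
    · intro j _ hj; simp only [Finset.mem_range] at hj; simp [g, hj]
  have e2 : ∀ K : ℕ, ∑ j ∈ Finset.range (n0 * K), tmul n j (g j) =
      ∑ j ∈ Finset.range K, ∑ r ∈ Finset.range n0, tmul n (n0 * j + r : ℕ) (g (n0 * j + r)) := by
    intro K
    induction K with
    | zero => simp
    | succ K ih => rw [Finset.sum_range_succ, ← ih, mul_add, mul_one, Finset.sum_range_add]
  rw [e1, e2, Finset.sum_comm]
  refine hD.sum _ _ _ ?_
  intro r
  have := hD.horner1 m L (fun j => tmul n r (g (n0 * j + r)))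
    (fun j => hD.shift _ _ _ (hD.mono _ _ _ (by omega) (hg _)))
  convert this using 2 with j hj
  rw [tmul_tmul]; push_cast; rfl

lemma const (hD : Good n D n0) (hn : n ≠ 0) : ∃ M : ℤ, ∀ c : ZMod n, D M (Finsupp.single 0 c) := by
  have : NeZero n := ⟨hn⟩
  choose f hf using fun c : ZMod n => hD.abs (Finsupp.single 0 c)
  obtain ⟨M, hM⟩ := (Set.finite_range f).bddAbove
  exact ⟨M, fun c => hD.mono _ _ _ (hM ⟨c, rfl⟩) (hf c)⟩

lemma bplus (hD : Good n D n0) (hn : n ≠ 0) : ∃ k : ℤ, ∀ (y : ℤ) (p : Rn n),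
    (∀ x, x < y → p x = 0) → D (k - y) p := by
  obtain ⟨M, hM⟩ := hD.const hn
  refine ⟨M + n0 + n0 * n0, fun y p hp => ?_⟩
  suffices D (M + n0 + n0 * n0) (tmul n (-y) p) by
    have := hD.shift' _ _ _ this
    rwa [← sub_eq_add_neg] at this
  set q := tmul n (-y) p with hq
  have hq0 : ∀ x < 0, q x = 0 := by
    intro x hx; rw [hq, tmul_apply']; apply hp; omega
  obtain ⟨B, hB⟩ := (q.support.finite_toSet).bddAbove
  have : q = ∑ j ∈ Finset.range (B.toNat + 1), tmul n j (Finsupp.single 0 (q j)) := by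
    ext x
    simp only [tmul_single, Finsupp.finsetSum_apply, Finsupp.single_apply, zero_add]
    by_cases hx : 0 ≤ x
    · lift x to ℕ using hx
      simp only [Nat.cast_inj, Finset.sum_ite_eq', Finset.mem_range]
      split_ifs with h
      · rfl
      · by_contra h0
        have := hB (by simpa using h0 : (x : ℤ) ∈ (q.support : Set ℤ))
        omega
    · rw [hq0 x (by omega), Finset.sum_eq_zero]
      intro j _; rw [if_neg]; omega
  rw [this]
  exact hD.horner _ _ _ (fun j => hM _)

/-- the kernel -/
def K (hD : Good n D n0) : AddSubmonoid (Rn n) where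
  carrier := {p | ∀ m, D m p}
  zero_mem' := hD.zero
  add_mem' := by
    intro a b ha hb m
    have := hD.add (m - n0) a b (ha _) (hb _)
    simpa using this

def HH (hD : Good n D n0) (hn : n ≠ 0) : AddSubgroup (ZMod n) where
  carrier := {c | Finsupp.single 0 c ∈ hD.K}
  zero_mem' := by simp [zero_mem]
  add_mem' := by
    intro a b ha hb
    simp only [Set.mem_ofPred_eq, Finsupp.single_add] at *
    exact add_mem ha hb
  neg_mem' := by
    intro a ha m
    rw [Finsupp.single_neg]
    have := hD.neg hn (m - n0 * n) _ (ha _)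
    simpa using this

lemma mem_K (hD : Good n D n0) (hn : n ≠ 0) (p : Rn n) (hp : ∀ x, p x ∈ hD.HH hn) (m : ℤ) :
    D m p := by
  suffices p ∈ hD.K from this m
  rw [← Finsupp.sum_single p]
  refine sum_mem fun x _ => ?_
  intro m
  have h := hp x (m + x)
  have := hD.shift _ _ _ h
  rwa [tmul_single, zero_add] at this

/-- `p` with coefs in `H` below `y`. -/
lemma upper (hD : Good n D n0) (hn : n ≠ 0) : ∃ k : ℤ, ∀ (y : ℤ) (p : Rn n),
    (∀ x, x < y → p x ∈ hD.HH hn) → D (k - y) p := by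
  obtain ⟨k, hk⟩ := hD.bplus hn
  refine ⟨k + n0, fun y p hp => ?_⟩
  have h1 : D (k - y) (p.filter (fun x => x < y)) := by
    apply hD.mem_K hn
    intro x
    rw [Finsupp.filter_apply]; split_ifs with h
    · exact hp x h
    · exact zero_mem _
  have h2 : D (k - y) (p.filter (fun x => ¬ x < y)) := by
    apply hk
    intro x hx
    rw [Finsupp.filter_apply, if_neg]; simpa using hx
  have := hD.add _ _ _ h1 h2
  rw [Finsupp.filter_add_filter_not] at this
  convert this using 1; ring

lemma low (hD : Good n D n0) (hn : n ≠ 0) : ∃ M : ℤ, ∀ c : ZMod n,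
    D (-M) (Finsupp.single 0 c) → c ∈ hD.HH hn := by
  have : NeZero n := ⟨hn⟩
  have : ∀ c : ZMod n, ∃ M : ℤ, D (-M) (Finsupp.single 0 c) → c ∈ hD.HH hn := by
    intro c
    by_cases hc : c ∈ hD.HH hn
    · exact ⟨0, fun _ => hc⟩
    · have : ¬ ∀ m, D m (Finsupp.single 0 c) := hc
      push Not at this
      obtain ⟨m, hm⟩ := this
      exact ⟨-m, fun h => absurd (by simpa using h) hm⟩
  choose f hf using this
  obtain ⟨M, hM⟩ := (Set.finite_range f).bddAbove
  refine ⟨M, fun c h => hf c (hD.mono _ _ _ ?_ h)⟩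
  have := hM ⟨c, rfl⟩
  omega

end Good

lemma prime_tors {n : ℕ} (hn : n ≠ 0) (H : AddSubgroup (ZMod n)) (l : ℕ) (hl : l.Prime)
    (c d : ZMod n) (hc : c ∉ H) (hlc : l • c ∈ H) (hld : l • d ∈ H) :
    ∃ a : ℕ, a • c + d ∈ H := by
  have : NeZero n := ⟨hn⟩
  obtain ⟨m, hm⟩ := Int.subgroup_cyclic (H.comap (Int.castAddHom (ZMod n)))
  have key : ∀ x : ℤ, (x : ZMod n) ∈ H ↔ m ∣ x := by
    intro x
    have : x ∈ H.comap (Int.castAddHom (ZMod n)) ↔ m ∣ x := by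
      rw [hm, ← AddSubgroup.zmultiples_eq_closure, Int.mem_zmultiples_iff]
    simpa using this
  obtain ⟨x, rfl⟩ := ZMod.intCast_surjective c
  obtain ⟨y, rfl⟩ := ZMod.intCast_surjective d
  have e1 : m ∣ l * x := by rw [← key]; simpa using hlc
  have e2 : m ∣ l * y := by rw [← key]; simpa using hld
  rw [key] at hc
  have hlp : Prime (l : ℤ) := Nat.prime_iff_prime_int.1 hl
  have hlm : (l : ℤ) ∣ m := by
    by_contra h
    have : IsCoprime (l : ℤ) m := (hlp.coprime_iff_not_dvd).2 h
    exact hc (this.symm.dvd_of_dvd_mul_left e1)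
  obtain ⟨m', rfl⟩ := hlm
  have hl0 : (l : ℤ) ≠ 0 := hlp.ne_zero
  obtain ⟨x', rfl⟩ := (mul_dvd_mul_iff_left hl0).1 e1
  obtain ⟨y', rfl⟩ := (mul_dvd_mul_iff_left hl0).1 e2
  have hx' : ¬ (l : ℤ) ∣ x' := by
    rintro ⟨z, rfl⟩
    exact hc ⟨z, by ring⟩
  obtain ⟨u, v, huv⟩ := (hlp.coprime_iff_not_dvd).2 hx'
  -- u * l + v * x' = 1 
  let a : ℤ := (-(v * y')) % l
  have ha : 0 ≤ a := Int.emod_nonneg _ hl0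
  refine ⟨a.toNat, ?_⟩
  have : a.toNat • ((m' * x' : ℤ) : ZMod n) + ((m' * y' : ℤ) : ZMod n)
      = ((a * (m' * x') + m' * y' : ℤ) : ZMod n) := by
    have h : ((a.toNat : ℕ) : ZMod n) = (a : ZMod n) := by
      conv_rhs => rw [← Int.toNat_of_nonneg ha]
      rw [Int.cast_natCast]
    rw [nsmul_eq_mul, h]; push_cast; ring
  rw [this, key]
  obtain ⟨w, hw⟩ : ∃ w, a = -(v * y') - l * w := ⟨(-(v * y')) / l, by
    have := Int.emod_add_mul_ediv (-(v * y')) l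
    simp only [a]; linarith⟩
  refine ⟨u * y' - w * x', ?_⟩
  rw [hw]
  linear_combination (-(m' * y')) * huv

namespace Good
variable {n : ℕ} {D : ℤ → Rn n → Prop} {n0 : ℕ}

lemma elim (hn : n ≠ 0) (H : AddSubgroup (ZMod n)) (l : ℕ) (hl : l.Prime)
    (p : Rn n) (hp : ∀ x, l • p x ∈ H) (x0 : ℤ) (h0 : p x0 ∉ H) (hlt : ∀ x < x0, p x ∈ H)
    (L : ℕ) : ∃ g : ℕ → ℕ, ∀ q, q = ∑ j ∈ Finset.range (L + 1), tmul n j (g j • p) →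
      (∀ x, l • q x ∈ H) ∧
      ∀ x < x0 + L + 1, (q - Finsupp.single x0 (p x0)) x ∈ H := by
  induction L with
  | zero =>
    refine ⟨fun _ => 1, ?_⟩
    rintro q rfl
    simp only [zero_add, Finset.sum_range_one, one_smul, Nat.cast_zero, tmul_zero']
    refine ⟨hp, fun x hx => ?_⟩
    rw [Finsupp.sub_apply, Finsupp.single_apply]
    split_ifs with h
    · subst h; simp [zero_mem]
    · simpa using hlt x (by omega)
  | succ L ih =>
    obtain ⟨g, hg⟩ := ih
    obtain ⟨hq1, hq2⟩ := hg _ rfl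
    set q := ∑ j ∈ Finset.range (L + 1), tmul n j (g j • p) with hqdef
    obtain ⟨a, ha⟩ := prime_tors hn H l hl (p x0) (q (x0 + L + 1)) h0 (hp _) (hq1 _)
    refine ⟨Function.update g (L + 1) a, ?_⟩
    intro q' hq'
    have e : q' = q + tmul n (L + 1 : ℕ) (a • p) := by
      rw [hq', Finset.sum_range_succ, hqdef]
      congr 1
      · refine Finset.sum_congr rfl fun j hj => ?_
        rw [Function.update_of_ne]
        have := Finset.mem_range.1 hj; omega
      · simp
    have e' : ∀ x, q' x = q x + a • p (x - (L + 1)) := by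
      intro x; rw [e, Finsupp.add_apply, tmul_apply', Finsupp.smul_apply]; push_cast; rfl
    constructor
    · intro x
      rw [e', smul_add, smul_comm]
      exact add_mem (hq1 x) (H.nsmul_mem (hp _) _)
    · intro x hx
      push_cast at hx
      rw [Finsupp.sub_apply, e']
      by_cases h : x < x0 + L + 1
      · have h1 := hq2 x h
        have h2 := H.nsmul_mem (hlt (x - (L + 1)) (by omega)) a
        have := add_mem h1 h2
        rw [Finsupp.sub_apply] at this
        convert this using 1; abel
      · have hx' : x = x0 + L + 1 := by omega
        rw [Finsupp.single_apply, if_neg (by omega), hx']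
        have : x0 + (L:ℤ) + 1 - (L + 1) = x0 := by ring
        rw [this, sub_zero, add_comm]; exact ha

lemma prime_step (hD : Good n D n0) (hn : n ≠ 0) (l : ℕ) (hl : l.Prime) (m : ℤ) :
    ∃ C : ℤ, ∀ p, D m p → (∀ x, l • p x ∈ hD.HH hn) → ∀ x < -C, p x ∈ hD.HH hn := by
  obtain ⟨M, hM⟩ := hD.low hn
  obtain ⟨k, hk⟩ := hD.upper hn
  set E : ℤ := m + n0 * n + n0 + n0 * n0 + n0 with hE
  refine ⟨E + M, fun p hp hlp => ?_⟩
  by_contra hcon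
  push Not at hcon
  obtain ⟨x1, hx1, hx1'⟩ := hcon
  -- minimal position
  obtain ⟨B, hB⟩ := (p.support.finite_toSet).bddBelow
  obtain ⟨x0, hx0, hmin⟩ := Int.exists_least_of_bdd (P := fun x => p x ∉ hD.HH hn)
    ⟨B, fun z hz => hB (by
      have : p z ≠ 0 := fun h => hz (h ▸ zero_mem _)
      simpa using this)⟩ ⟨x1, hx1'⟩
  have hle : x0 ≤ x1 := hmin _ hx1'
  have hlt : ∀ x < x0, p x ∈ hD.HH hn := by
    intro x hx; by_contra h; have := hmin x h; omega
  let L : ℕ := (k - x0 - (E - n0 - n0 * n)).toNat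
  obtain ⟨g, hg⟩ := elim hn (hD.HH hn) l hl p hlp x0 hx0 hlt L
  obtain ⟨-, h2⟩ := hg _ rfl
  set q := ∑ j ∈ Finset.range (L + 1), tmul n j (g j • p) with hq
  have hDq : D (E - n0) q := by
    have := hD.horner (m + n0 * n) (L + 1) (fun j => g j • p) (fun j => hD.nsmul hn m p hp _)
    refine hD.mono _ _ _ ?_ this
    rw [hE]; ring_nf; rfl
  have h3 := hk (x0 + L + 1) _ h2
  have h4 := hD.neg hn (E - n0 - n0 * n) _ (hD.mono _ _ _ (by omega) h3)
  rw [sub_add_cancel] at h4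
  have h5 := hD.add _ _ _ hDq h4
  have e : q + -(q - Finsupp.single x0 (p x0)) = tmul n x0 (Finsupp.single 0 (p x0)) := by
    rw [tmul_single, zero_add]; abel
  rw [e, sub_add_cancel] at h5
  exact hx0 (hM _ (hD.mono _ _ _ (by omega) (hD.shift' _ _ _ h5)))

lemma step (hD : Good n D n0) (hn : n ≠ 0) (d : ℕ) : d ≠ 0 → ∀ m : ℤ,
    ∃ C : ℤ, ∀ p, D m p → (∀ x, d • p x ∈ hD.HH hn) → ∀ x < -C, p x ∈ hD.HH hn := by
  induction d using induction_on_primes with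
  | zero => intro h; exact absurd rfl h
  | one => intro _ m; exact ⟨0, fun p _ h x _ => by simpa using h x⟩
  | prime_mul l d hl ih =>
    intro hld m
    have hd : d ≠ 0 := by rintro rfl; simp at hld
    obtain ⟨C1, hC1⟩ := ih hd (m + n0 * n)
    obtain ⟨k, hk⟩ := hD.bplus hn
    set m2 := max m (k + C1 + n0 * n) with hm2
    obtain ⟨C2, hC2⟩ := hD.prime_step hn l hl (m2 + n0)
    refine ⟨max C1 C2, fun p hp hlp => ?_⟩
    have h1 := hC1 (l • p) (hD.nsmul hn m p hp l) (fun x => by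
      have := hlp x
      rwa [Finsupp.smul_apply, smul_smul, mul_comm d l])
    have h2 : D (k - -C1) (p.filter (fun x => ¬ x < -C1)) := by
      apply hk
      intro x hx
      rw [Finsupp.filter_apply, if_neg]; simpa using hx
    have h3 := hD.neg hn _ _ h2
    have h4 := hD.add m2 _ _ (hD.mono _ _ _ (le_max_left _ _) hp)
      (hD.mono _ _ _ (by rw [hm2, sub_neg_eq_add]; exact le_max_right _ _) h3)
    have e : p + -(p.filter (fun x => ¬ x < -C1)) = p.filter (fun x => x < -C1) := by
      conv_lhs => enter [1]; rw [← Finsupp.filter_add_filter_not p (fun x => x < -C1)]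
      abel
    rw [e] at h4
    have h5 := hC2 _ h4 (fun x => by
      rw [Finsupp.filter_apply]; split_ifs with h
      · simpa using h1 x h
      · simp [zero_mem])
    intro x hx
    have := h5 x (by omega)
    rwa [Finsupp.filter_apply, if_pos (by omega)] at this

lemma final (hD : Good n D n0) (hn : n ≠ 0) (m : ℤ) :
    ∃ C : ℤ, ∀ p, D m p → ∀ x < -C, p x ∈ hD.HH hn := by
  obtain ⟨C, h⟩ := hD.step hn n hn m
  exact ⟨C, fun p hp => h p hp (fun x => by simp [zero_mem])⟩

end Good

lemma iota_conj (n : ℕ) (m : ℕ) (p : Rn n) :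
    tL n ^ m * ι n p * (tL n)⁻¹ ^ m = ι n (tmul n m p) := by
  induction m generalizing p with
  | zero => simp [tmul_zero']
  | succ m ih =>
    have h1 : tL n * ι n p * (tL n)⁻¹ = ι n (tmul n 1 p) := by
      unfold tL ι
      rw [← map_inv, ← SemidirectProduct.inl_aut]
      simp
    calc tL n ^ (m + 1) * ι n p * (tL n)⁻¹ ^ (m + 1)
        = tL n ^ m * (tL n * ι n p * (tL n)⁻¹) * (tL n)⁻¹ ^ m := by
          rw [pow_succ, pow_succ' (tL n)⁻¹]; group
      _ = _ := by rw [h1, ih, tmul_tmul]; push_cast; rfl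

lemma mem_wordBall (n : ℕ) (Q : Set (Rn n)) (m : ℕ) (p : Rn n) (h : tmul n m p ∈ Q) :
    ι n p ∈ wordBall (Sgen n Q) (2 * m + 1) := by
  refine ⟨List.replicate m (tL n)⁻¹ ++ [ι n (tmul n m p)] ++ List.replicate m (tL n), ?_, ?_, ?_⟩
  · simp; omega
  · intro x hx
    left
    simp only [List.mem_append, List.mem_replicate, List.mem_singleton] at hx
    rcases hx with (⟨-, rfl⟩ | rfl) | ⟨-, rfl⟩
    · right; simp
    · left; exact ⟨_, h, rfl⟩
    · right; simp
  · rw [List.prod_append, List.prod_append, List.prod_replicate, List.prod_replicate,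
      List.prod_singleton, ← iota_conj]
    simp [mul_assoc]

lemma sgen_ball (n : ℕ) (Q Q' : Set (Rn n)) (m N : ℕ) (hN : 2 * m + 1 ≤ N)
    (h : ∀ p ∈ Q, tmul n m p ∈ Q') : ∀ s ∈ Sgen n Q, s ∈ wordBall (Sgen n Q') N := by
  rintro s (⟨p, hp, rfl⟩ | hs)
  · obtain ⟨l, hl, h2⟩ := mem_wordBall n Q' m p (h p hp)
    exact ⟨l, hl.trans hN, h2⟩
  · refine ⟨[s], by simp; omega, ?_, by simp⟩
    intro x hx
    rw [List.mem_singleton] at hx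
    subst hx
    exact Or.inl (Or.inr hs)

/-- If `t` strictly confines `R` into `Q` and `S = Q ∪ {t, t⁻¹}`, then
there are a proper subgroup `H < ℤ_n` and `N ∈ ℕ` such that each element of `S` is a
product of at most `N` elements of `S_H ∪ S_H⁻¹` and vice versa, where
`S_H = Q_H ∪ {t, t⁻¹}`. In particular `S` and `S_H` give bi-Lipschitz equivalent word
metrics on `L_n`. -/
theorem confining_gives_QH_structure (n : ℕ) (hn : 2 ≤ n) (Q : Set (Rn n))
    (hQ : StrictlyConfinesT n Q) :
    ∃ H : AddSubgroup (ZMod n), H ≠ ⊤ ∧ ∃ N : ℕ,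
      (∀ s ∈ Sgen n Q, s ∈ wordBall (Sgen n (QHlamp n H)) N) ∧
      (∀ s ∈ Sgen n (QHlamp n H), s ∈ wordBall (Sgen n Q) N) := by
  have hn0 : n ≠ 0 := by omega
  obtain ⟨n0, hD⟩ := good_of_confines n Q hQ.1
  refine ⟨hD.HH hn0, ?_, ?_⟩
  · intro htop
    apply hQ.2.2
    intro p _
    have := hD.mem_K hn0 p (fun x => by rw [htop]; trivial) (-1)
    refine ⟨_, this, ?_⟩
    rw [tmul_tmul]; simp [tmul_zero']
  · obtain ⟨C, hC⟩ := hD.final hn0 0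
    obtain ⟨k, hk⟩ := hD.upper hn0
    refine ⟨2 * max C.toNat k.toNat + 1, ?_, ?_⟩
    · apply sgen_ball n _ _ C.toNat _ (by omega)
      intro p hp i hi
      rw [tmul_apply']
      exact hC p (by simpa [tmul_zero'] using hp) _ (by omega)
    · apply sgen_ball n _ _ k.toNat _ (by omega)
      intro p hp
      refine hD.mono _ _ _ ?_ (hk 0 p ?_)
      · omega
      · intro x hx
        have := hp (-x) (by omega)
        rwa [neg_neg] at this
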